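/- Let F: N′ → N be a homomorphism of free abelian groups of finite rank, and let P′ ⊆ N′ and Q ⊆ N be subgroups with rk(F(N′)) = rk(N) = rk(F(P′)+Q). Then all the group indices below are finite and [F(P′)_ℝ ∩ Q : F(P′ ∩ F^{-1}(Q))] · [N′ : P′ + F^{-1}(Q)] · [N : F(N′) + Q] = [N : (F(P′)_ℝ ∩ N) + Q] · [F(P′)_ℝ ∩ N : F(P′)]. -/

import Mathlib

open scoped TensorProduct

noncomputable section

namespace LatticeIndex

variable {N' N : Type*} [AddCommGroup N'] [AddCommGroup N]

/-- The index `[A : B]` of two subgroups (submodules) of a ℤ-module, intended for `B ≤ A`: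
the index of `B ⊓ A` in `A`. -/
def ind {M : Type*} [AddCommGroup M] (A B : Submodule ℤ M) : ℕ :=
  B.toAddSubgroup.relIndex A.toAddSubgroup

/-- The canonical map `N → ℝ ⊗[ℤ] N`, `x ↦ 1 ⊗ x`, realising `N` inside `N_ℝ = N ⊗ ℝ`. -/
def toReal (N : Type*) [AddCommGroup N] : N →ₗ[ℤ] ℝ ⊗[ℤ] N :=
  TensorProduct.mk ℤ ℝ N 1

/-- For a subgroup `A` of `N`, the subgroup `A_ℝ ∩ N` of `N`: the elements of `N` whose
image in `N_ℝ = ℝ ⊗[ℤ] N` lies in the ℝ-linear span `A_ℝ` of (the image of) `A`. -/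
def realSpanInter (A : Submodule ℤ N) : Submodule ℤ N :=
  Submodule.comap (toReal N)
    ((Submodule.span ℝ (⇑(toReal N) '' (A : Set N))).restrictScalars ℤ)

/-- An element of `A_ℝ ∩ N` has a nonzero integer multiple in `A`. -/
theorem exists_smul_mem_of_mem_realSpanInter [Module.Finite ℤ N] (A : Submodule ℤ N) (x : N)
    (hx : x ∈ realSpanInter A) : ∃ a : nonZeroDivisors ℤ, (a : ℤ) • x ∈ A := by
  let g : N →ₗ[ℤ] ((N ⧸ A) ⧸ Submodule.torsion ℤ (N ⧸ A)) :=
    (Submodule.torsion ℤ (N ⧸ A)).mkQ ∘ₗ A.mkQ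
  have hle : Submodule.span ℝ (⇑(toReal N) '' (A : Set N)) ≤
      LinearMap.ker (g.baseChange ℝ) := by
    rw [Submodule.span_le]
    rintro _ ⟨a, ha, rfl⟩
    have h0 : A.mkQ a = 0 := by simpa using ha
    change (g.baseChange ℝ) ((1 : ℝ) ⊗ₜ[ℤ] a) = 0
    rw [LinearMap.baseChange_tmul]
    have h1 : g a = 0 := by
      change (Submodule.torsion ℤ (N ⧸ A)).mkQ (A.mkQ a) = 0
      rw [h0, map_zero]
    rw [h1, TensorProduct.tmul_zero]
  have h1 : (1 : ℝ) ⊗ₜ[ℤ] g x = 0 := by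
    have : (g.baseChange ℝ) ((1 : ℝ) ⊗ₜ[ℤ] x) = 0 := hle hx
    rwa [LinearMap.baseChange_tmul] at this
  have : Module.Free ℤ ((N ⧸ A) ⧸ Submodule.torsion ℤ (N ⧸ A)) := inferInstance
  have h2 : g x = 0 := by
    have hinj := Module.Flat.tensorProduct_mk_injective (R := ℤ) (S := ℝ)
      (M := (N ⧸ A) ⧸ Submodule.torsion ℤ (N ⧸ A))
    apply hinj
    rw [map_zero]
    exact h1
  have h3 : A.mkQ x ∈ Submodule.torsion ℤ (N ⧸ A) := by
    simpa [g] using h2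
  obtain ⟨a, ha⟩ := (Submodule.mem_torsion_iff _).1 h3
  refine ⟨a, ?_⟩
  rw [← Submodule.Quotient.mk_eq_zero]
  exact ha

theorem ind_realSpanInter_ne_zero [Module.Finite ℤ N] (A : Submodule ℤ N) :
    ind (realSpanInter A) A ≠ 0 := by
  have : Finite (↥(realSpanInter A) ⧸ A.comap (realSpanInter A).subtype) := by
    apply Module.finite_of_fg_torsion
    intro y
    obtain ⟨⟨x, hx⟩, rfl⟩ := Submodule.Quotient.mk_surjective _ y
    obtain ⟨a, ha⟩ := exists_smul_mem_of_mem_realSpanInter A x hx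
    refine ⟨a, ?_⟩
    change (a : ℤ) • (Submodule.Quotient.mk ⟨x, hx⟩ : ↥(realSpanInter A) ⧸
      A.comap (realSpanInter A).subtype) = 0
    rw [← Submodule.Quotient.mk_smul, Submodule.Quotient.mk_eq_zero]
    exact ha
  have h2 : Finite (↥(realSpanInter A).toAddSubgroup ⧸
    A.toAddSubgroup.addSubgroupOf (realSpanInter A).toAddSubgroup) := this
  exact AddSubgroup.index_ne_zero_of_finite

theorem le_realSpanInter (A : Submodule ℤ N) : A ≤ realSpanInter A := fun _ hx =>
  Submodule.subset_span (Set.mem_image_of_mem _ hx)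

/-- If `H ≤ K` then `[K ⊔ Q : H ⊔ Q] = [K : H ⊔ (K ⊓ Q)]`. -/
theorem relIndex_aux {G : Type*} [AddCommGroup G] {H K : AddSubgroup G} (Q : AddSubgroup G)
    (h : H ≤ K) : (H ⊔ Q).relIndex (K ⊔ Q) = (H ⊔ Q ⊓ K).relIndex K := by
  have e : K ⊔ Q = K ⊔ (H ⊔ Q) := by
    rw [← sup_assoc, sup_eq_left.2 h]
  rw [e, AddSubgroup.relIndex_sup_right, ← AddSubgroup.inf_relIndex_right, ← sup_inf_assoc_of_le Q h]

/-- The group-theoretic identity. -/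
theorem index_aux {G : Type*} [AddCommGroup G] {A R S : AddSubgroup G} (Q : AddSubgroup G)
    (hR : A ≤ R) (hS : A ≤ S) :
    (A ⊔ Q ⊓ R).relIndex R * (R ⊔ Q).index = (A ⊔ Q).index ∧
    (A ⊓ Q).relIndex (Q ⊓ S) * (A ⊔ Q).index = (S ⊔ Q).index * A.relIndex S := by
  refine ⟨?_, ?_⟩
  · rw [← relIndex_aux Q hR, AddSubgroup.relIndex_mul_index (sup_le_sup_right hR Q)]
  · rw [← AddSubgroup.relIndex_mul_index (sup_le_sup_right hS Q), relIndex_aux Q hS]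
    have h1 : (A ⊓ Q).relIndex (Q ⊓ S) = A.relIndex (A ⊔ Q ⊓ S) := by
      rw [AddSubgroup.relIndex_sup_left, ← AddSubgroup.inf_relIndex_right A (Q ⊓ S),
        ← inf_assoc, inf_eq_left.2 (inf_le_left.trans hS)]
    rw [h1, ← mul_assoc, AddSubgroup.relIndex_mul_relIndex _ _ _ le_sup_left
      (sup_le hS inf_le_right), mul_comm]

theorem toAddSubgroup_sup' (A B : Submodule ℤ N) :
    (A ⊔ B).toAddSubgroup = A.toAddSubgroup ⊔ B.toAddSubgroup :=
  Submodule.sup_toAddSubgroup A B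

/-- **Projection formula for lattices** (Lemma 6.6).
Let `F : N′ → N` be a homomorphism of free abelian groups of finite rank, and let
`P′ ⊆ N′` and `Q ⊆ N` be subgroups with `rk(F(N′)) = rk(N) = rk(F(P′)+Q)`.  Then all the
group indices below are finite and
`[F(P′)_ℝ ∩ Q : F(P′ ∩ F⁻¹(Q))] · [N′ : P′ + F⁻¹(Q)] · [N : F(N′) + Q]
  = [N : (F(P′)_ℝ ∩ N) + Q] · [F(P′)_ℝ ∩ N : F(P′)]`. -/
theorem projection_formula_for_lattices
    [Module.Free ℤ N'] [Module.Finite ℤ N'] [Module.Free ℤ N] [Module.Finite ℤ N]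
    (F : N' →ₗ[ℤ] N) (P' : Submodule ℤ N') (Q : Submodule ℤ N)
    (hrk₁ : Module.finrank ℤ ↥(LinearMap.range F) = Module.finrank ℤ N)
    (hrk₂ : Module.finrank ℤ ↥(Submodule.map F P' ⊔ Q) = Module.finrank ℤ N) :
    ind (Q ⊓ realSpanInter (Submodule.map F P'))
        (Submodule.map F (P' ⊓ Submodule.comap F Q)) ≠ 0 ∧
    (P' ⊔ Submodule.comap F Q).toAddSubgroup.index ≠ 0 ∧
    (LinearMap.range F ⊔ Q).toAddSubgroup.index ≠ 0 ∧
    (realSpanInter (Submodule.map F P') ⊔ Q).toAddSubgroup.index ≠ 0 ∧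
    ind (realSpanInter (Submodule.map F P')) (Submodule.map F P') ≠ 0 ∧
    ind (Q ⊓ realSpanInter (Submodule.map F P'))
        (Submodule.map F (P' ⊓ Submodule.comap F Q)) *
      (P' ⊔ Submodule.comap F Q).toAddSubgroup.index *
      (LinearMap.range F ⊔ Q).toAddSubgroup.index =
    (realSpanInter (Submodule.map F P') ⊔ Q).toAddSubgroup.index *
      ind (realSpanInter (Submodule.map F P')) (Submodule.map F P') := by
  have hfin : (Submodule.map F P' ⊔ Q).toAddSubgroup.index ≠ 0 := by
    have := (Submodule.finiteQuotient_iff (Submodule.map F P' ⊔ Q)).2 hrk₂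
    have h2 : Finite (N ⧸ (Submodule.map F P' ⊔ Q).toAddSubgroup) := this
    exact AddSubgroup.index_ne_zero_of_finite
  have hSA := ind_realSpanInter_ne_zero (Submodule.map F P')
  have hS := le_realSpanInter (Submodule.map F P')
  have hR : Submodule.map F P' ≤ LinearMap.range F := LinearMap.map_le_range
  have hcap : Submodule.map F (P' ⊓ Submodule.comap F Q) = Submodule.map F P' ⊓ Q :=
    le_antisymm (by
      rintro _ ⟨x, ⟨h1, h2⟩, rfl⟩
      exact ⟨⟨x, h1, rfl⟩, h2⟩) (by
      rintro _ ⟨⟨x, h1, rfl⟩, h2⟩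
      exact ⟨x, ⟨h1, h2⟩, rfl⟩)
  have hidx : (P' ⊔ Submodule.comap F Q).toAddSubgroup.index =
      (Submodule.map F P' ⊔ Q ⊓ LinearMap.range F).toAddSubgroup.relIndex
        (LinearMap.range F).toAddSubgroup := by
    have hc : P' ⊔ Submodule.comap F Q =
        Submodule.comap F (Submodule.map F P' ⊔ Q ⊓ LinearMap.range F) := by
      have h : Submodule.map F (P' ⊔ Submodule.comap F Q) =
          Submodule.map F P' ⊔ Q ⊓ LinearMap.range F := by
        rw [Submodule.map_sup, Submodule.map_comap_eq, inf_comm]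
      rw [← h, Submodule.comap_map_eq, sup_assoc, sup_eq_left.2 (show LinearMap.ker F ≤ Submodule.comap F Q from
        fun x hx => by
          rw [Submodule.mem_comap, LinearMap.mem_ker.1 hx]
          exact Q.zero_mem)]
    rw [hc]
    have := AddSubgroup.index_comap (Submodule.map F P' ⊔ Q ⊓ LinearMap.range F).toAddSubgroup F.toAddMonoidHom
    rw [LinearMap.range_toAddSubgroup]
    exact this
  rw [hcap, hidx]
  generalize realSpanInter (Submodule.map F P') = S at *
  generalize Submodule.map F P' = A at *
  generalize LinearMap.range F = R at *
  obtain ⟨e1, e2⟩ := index_aux (A := A.toAddSubgroup) (R := R.toAddSubgroup)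
    (S := S.toAddSubgroup) Q.toAddSubgroup hR hS
  simp only [ind, toAddSubgroup_sup'] at *
  change (A.toAddSubgroup ⊓ Q.toAddSubgroup).relIndex (Q.toAddSubgroup ⊓ S.toAddSubgroup) ≠ 0 ∧
    (A.toAddSubgroup ⊔ Q.toAddSubgroup ⊓ R.toAddSubgroup).relIndex R.toAddSubgroup ≠ 0 ∧ _ ∧ _ ∧ _ ∧
    (A.toAddSubgroup ⊓ Q.toAddSubgroup).relIndex (Q.toAddSubgroup ⊓ S.toAddSubgroup) *
    (A.toAddSubgroup ⊔ Q.toAddSubgroup ⊓ R.toAddSubgroup).relIndex R.toAddSubgroup * _ = _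
  have hSQ : (S.toAddSubgroup ⊔ Q.toAddSubgroup).index ≠ 0 := fun h0 => hfin <| by
    have := AddSubgroup.relIndex_mul_index
      (show A.toAddSubgroup ⊔ Q.toAddSubgroup ≤ S.toAddSubgroup ⊔ Q.toAddSubgroup from
        sup_le_sup_right (show A.toAddSubgroup ≤ S.toAddSubgroup from hS) _)
    rw [← this, h0, mul_zero]
  have hl : (A.toAddSubgroup ⊓ Q.toAddSubgroup).relIndex (Q.toAddSubgroup ⊓ S.toAddSubgroup) ≠ 0 :=
    left_ne_zero_of_mul (e2 ▸ mul_ne_zero hSQ hSA)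
  have h12 := e1 ▸ hfin
  refine ⟨hl, left_ne_zero_of_mul h12, right_ne_zero_of_mul h12, hSQ, hSA, ?_⟩
  rw [mul_assoc, e1, e2]

end LatticeIndex
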